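/- arXiv:1504.01517 — 9 statements merged into one kernel-verified Lean document; each statement's English description precedes it below -/
import Mathlib

section
/- Fix an integer n ≥ 3, reals r > 0, ε ∈ [0,1), and α ∈ (0, 2π/n) with π − αn sin²(π/n) ≠ 0. Set R_n = πr/(n sin(π/n)), a_n = 2(1−ε)r, and let T = (α n sin(2π/n)) / (2(π − α n sin²(π/n))). Then 1 + T·tan(π/n) ≠ 0, and with Y' = R_n·T/(1 + T·tan(π/n)) one has (Y'/cos(π/n))·a_n/2 = α(1−ε)r²; that is, Y' = α r cos(π/n). -/
open Real

/-- The relation `tan β = (α n sin(2π/n)) / (2(π − α n sin²(π/n)))` makes the area of the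
planar triangle `A'C'M'` on a face of the pyramid equal to the area `α(1−ε)r²` of the
corresponding spherical slice; equivalently `Y' = α r cos(π/n)`. -/
theorem triangleSliceArea (n : ℕ) (hn : 3 ≤ n) (r ε α : ℝ)
    (hr : 0 < r) (hε0 : 0 ≤ ε) (hε1 : ε < 1)
    (hα0 : 0 < α) (hα1 : α < 2 * π / n)
    (hden : π - α * n * sin (π / n) ^ 2 ≠ 0) :
    1 + (α * n * sin (2 * π / n) / (2 * (π - α * n * sin (π / n) ^ 2))) * tan (π / n) ≠ 0 ∧
    ((π * r / (n * sin (π / n))) *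
        (α * n * sin (2 * π / n) / (2 * (π - α * n * sin (π / n) ^ 2))) /
        (1 + (α * n * sin (2 * π / n) / (2 * (π - α * n * sin (π / n) ^ 2))) * tan (π / n))) /
        cos (π / n) * (2 * (1 - ε) * r) / 2 = α * (1 - ε) * r ^ 2 ∧
    (π * r / (n * sin (π / n))) *
        (α * n * sin (2 * π / n) / (2 * (π - α * n * sin (π / n) ^ 2))) /
        (1 + (α * n * sin (2 * π / n) / (2 * (π - α * n * sin (π / n) ^ 2))) * tan (π / n))
      = α * r * cos (π / n) := by
  have hn3 : (3 : ℝ) ≤ n := by exact_mod_cast hn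
  have hn0 : (n : ℝ) ≠ 0 := by positivity
  have hnpos : (0 : ℝ) < n := by linarith
  have hlt : π / n < π / 2 := by
    apply div_lt_div_of_pos_left pi_pos (by norm_num) (by linarith)
  have hpos : 0 < π / n := div_pos pi_pos hnpos
  have hs : sin (π / n) ≠ 0 := (sin_pos_of_pos_of_lt_pi hpos (by linarith [pi_pos])).ne'
  have hc : cos (π / n) ≠ 0 := (cos_pos_of_mem_Ioo ⟨by linarith, hlt⟩).ne'
  have h2 : sin (2 * π / n) = 2 * sin (π / n) * cos (π / n) := by
    rw [mul_div_assoc, sin_two_mul]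
  have hpi : π ≠ 0 := pi_ne_zero
  rw [h2, tan_eq_sin_div_cos]
  generalize sin (π / n) = s at *
  generalize cos (π / n) = c at *
  obtain ⟨D, hD⟩ : ∃ D, D = π - α * n * s ^ 2 := ⟨_, rfl⟩
  rw [← hD] at hden ⊢
  have key : 1 + (α * n * (2 * s * c) / (2 * D)) * (s / c) = π / D := by
    field_simp
    rw [hD]
    ring
  rw [key]
  have hY : (π * r / (n * s)) * (α * n * (2 * s * c) / (2 * D)) / (π / D) = α * r * c := by
    field_simp
  rw [hY]
  refine ⟨div_ne_zero hpi hden, ?_, rfl⟩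
  field_simp
end

section
/- Fix an integer n ≥ 3, reals r > 0, ε ∈ [0,1) with 4(1−ε)² ≥ (π²/n²)·cot²(π/n), set b_n = r·√(4(1−ε)² − (π²/n²)·cot²(π/n)), fix i ∈ {0,…,n−1} and α_i = 2iπ/n, and define σ(φ,θ) = (X,Y,Z) by X = r√(2/(1−ε))·(π cos α_i/(n sin(π/n)) − sin((2i+1)π/n)·(θ − α_i))·sin(φ/2), Y = r√(2/(1−ε))·(π sin α_i/(n sin(π/n)) + cos((2i+1)π/n)·(θ − α_i))·sin(φ/2), Z = εr + b_n(1 − √(2/(1−ε))·sin(φ/2)). Then for all φ ∈ (0, π) and θ the first fundamental form coefficients are E' = (∂_φX)² + (∂_φY)² + (∂_φZ)² = (r²/(2(1−ε)))·(4(1−ε)² + (θ − (2i+1)π/n)²)·cos²(φ/2), F' = ∂_φX·∂_θX + ∂_φY·∂_θY + ∂_φZ·∂_θZ = (r²/(2(1−ε)))·(θ − (2i+1)π/n)·sin φ, and G' = (∂_θX)² + (∂_θY)² + (∂_θZ)² = (2r²/(1−ε))·sin²(φ/2). -/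
open Real

/-- The coefficients of the first fundamental form of the spherical-coordinate expression
of the map `T_n⁺` on the sector `I_i⁺`. -/
theorem firstFundamentalFormCoeffs (n : ℕ) (hn : 3 ≤ n) (r ε : ℝ)
    (hr : 0 < r) (hε0 : 0 ≤ ε) (hε1 : ε < 1)
    (hcond : 4 * (1 - ε) ^ 2 ≥ π ^ 2 / n ^ 2 * (cos (π / n) / sin (π / n)) ^ 2)
    (i : ℕ) (hi : i < n) :
    let b : ℝ := r * sqrt (4 * (1 - ε) ^ 2 - π ^ 2 / n ^ 2 * (cos (π / n) / sin (π / n)) ^ 2)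
    let α : ℝ := 2 * i * π / n
    let X : ℝ → ℝ → ℝ := fun φ θ =>
      r * sqrt (2 / (1 - ε)) *
        (π * cos α / (n * sin (π / n)) - sin ((2 * i + 1) * π / n) * (θ - α)) * sin (φ / 2)
    let Y : ℝ → ℝ → ℝ := fun φ θ =>
      r * sqrt (2 / (1 - ε)) *
        (π * sin α / (n * sin (π / n)) + cos ((2 * i + 1) * π / n) * (θ - α)) * sin (φ / 2)
    let Z : ℝ → ℝ → ℝ := fun φ _ => ε * r + b * (1 - sqrt (2 / (1 - ε)) * sin (φ / 2))
    ∀ φ θ : ℝ, 0 < φ → φ < π →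
      ((deriv (fun p => X p θ) φ) ^ 2 + (deriv (fun p => Y p θ) φ) ^ 2 +
          (deriv (fun p => Z p θ) φ) ^ 2
        = r ^ 2 / (2 * (1 - ε)) *
            (4 * (1 - ε) ^ 2 + (θ - (2 * i + 1) * π / n) ^ 2) * cos (φ / 2) ^ 2) ∧
      ((deriv (fun p => X p θ) φ) * (deriv (fun t => X φ t) θ) +
          (deriv (fun p => Y p θ) φ) * (deriv (fun t => Y φ t) θ) +
          (deriv (fun p => Z p θ) φ) * (deriv (fun t => Z φ t) θ)
        = r ^ 2 / (2 * (1 - ε)) * (θ - (2 * i + 1) * π / n) * sin φ) ∧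
      ((deriv (fun t => X φ t) θ) ^ 2 + (deriv (fun t => Y φ t) θ) ^ 2 +
          (deriv (fun t => Z φ t) θ) ^ 2
        = 2 * r ^ 2 / (1 - ε) * sin (φ / 2) ^ 2) := by
  intro b α X Y Z φ θ _ _
  have hn0 : (0 : ℝ) < n := by
    have : 0 < n := by omega
    exact_mod_cast this
  have hsin : 0 < sin (π / n) := by
    apply sin_pos_of_pos_of_lt_pi (by positivity)
    rw [div_lt_iff₀ hn0]
    have : (3 : ℝ) ≤ n := by exact_mod_cast hn
    nlinarith [pi_pos]
  have he : 0 < 1 - ε := by linarith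
  obtain ⟨s, hs⟩ : ∃ s, s = sqrt (2 / (1 - ε)) := ⟨_, rfl⟩
  have hs2 : s ^ 2 = 2 / (1 - ε) := by rw [hs]; exact sq_sqrt (by positivity)
  have hb2 : b ^ 2 = r ^ 2 * (4 * (1 - ε) ^ 2
      - π ^ 2 / n ^ 2 * (cos (π / n) / sin (π / n)) ^ 2) := by
    simp only [b]
    rw [mul_pow, sq_sqrt (by linarith)]
  obtain ⟨β, hβ⟩ : ∃ β, β = π / n := ⟨_, rfl⟩
  obtain ⟨p, hp⟩ : ∃ p, p = β / sin β := ⟨_, rfl⟩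
  have hγ : (2 * i + 1) * π / n = α + β := by simp only [α, hβ]; ring
  rw [← hβ] at hsin
  have hpβ : p * sin β = β := by rw [hp]; field_simp
  have hb2' : b ^ 2 = r ^ 2 * (4 * (1 - ε) ^ 2 - (p * cos β) ^ 2) := by
    rw [hb2, ← hβ, hp, ← div_pow, ← hβ]; ring
  have hA : ∀ x : ℝ, π * x / (n * sin (π / n)) = p * x := by
    intro x
    rw [← hβ, hp, hβ]; field_simp
  have hd : HasDerivAt (fun q : ℝ => sin (q / 2)) (cos (φ / 2) * (1 / 2)) φ :=
    ((hasDerivAt_id φ).div_const 2).sin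
  have hXφ : deriv (fun q => X q θ) φ
      = r * s * (p * cos α - sin (α + β) * (θ - α)) * (cos (φ / 2) * (1 / 2)) := by
    simp only [X, hA, hγ, ← hs]
    exact (hd.const_mul _).deriv
  have hYφ : deriv (fun q => Y q θ) φ
      = r * s * (p * sin α + cos (α + β) * (θ - α)) * (cos (φ / 2) * (1 / 2)) := by
    simp only [Y, hA, hγ, ← hs]
    exact (hd.const_mul _).deriv
  have hZφ : deriv (fun q => Z q θ) φ = b * (-(s * (cos (φ / 2) * (1 / 2)))) := by
    simp only [Z, ← hs]
    exact ((((hd.const_mul s).const_sub 1).const_mul b).const_add (ε * r)).deriv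
  have hu : HasDerivAt (fun t : ℝ => t - α) 1 θ := (hasDerivAt_id θ).sub_const α
  have hXθ : deriv (fun t => X φ t) θ = r * s * (-(sin (α + β) * 1)) * sin (φ / 2) := by
    simp only [X, hA, hγ, ← hs]
    exact ((((hu.const_mul _).const_sub _).const_mul _).mul_const _).deriv
  have hYθ : deriv (fun t => Y φ t) θ = r * s * (cos (α + β) * 1) * sin (φ / 2) := by
    simp only [Y, hA, hγ, ← hs]
    exact ((((hu.const_mul _).const_add _).const_mul _).mul_const _).deriv
  have hZθ : deriv (fun t => Z φ t) θ = 0 := by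
    simp only [Z]
    exact deriv_const _ _
  have h1 : cos (α + β) ^ 2 + sin (α + β) ^ 2 = 1 := cos_sq_add_sin_sq _
  have h2 : cos α ^ 2 + sin α ^ 2 = 1 := cos_sq_add_sin_sq _
  have h3 : cos β ^ 2 + sin β ^ 2 = 1 := cos_sq_add_sin_sq _
  have h4 : sin (α + β) * cos α - cos (α + β) * sin α = sin β := by
    rw [← sin_sub]; congr 1; ring
  have hφ : sin φ = 2 * sin (φ / 2) * cos (φ / 2) := by
    rw [← sin_two_mul]; congr 1; ring
  have hr1 : r ^ 2 / (2 * (1 - ε)) = r ^ 2 * s ^ 2 / 4 := by rw [hs2]; field_simp; norm_num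
  have hr2 : 2 * r ^ 2 / (1 - ε) = r ^ 2 * s ^ 2 := by rw [hs2]; ring
  rw [hXφ, hYφ, hZφ, hXθ, hYθ, hZθ, hγ, hr1, hr2, hφ]
  generalize sin (α + β) = S at *
  generalize cos (α + β) = C at *
  have hN : (p * cos α - S * (θ - α)) ^ 2 + (p * sin α + C * (θ - α)) ^ 2
      = (p * cos β) ^ 2 + (θ - (α + β)) ^ 2 := by
    linear_combination p ^ 2 * h2 + (θ - α) ^ 2 * h1 - 2 * p * (θ - α) * h4
      - 2 * (θ - α) * hpβ - p ^ 2 * h3 + (p * sin β + β) * hpβ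
  refine ⟨?_, ?_, ?_⟩
  · linear_combination (r * s * cos (φ / 2) / 2) ^ 2 * hN + (s * cos (φ / 2) / 2) ^ 2 * hb2'
  · linear_combination r ^ 2 * s ^ 2 * sin (φ / 2) * cos (φ / 2) / 2 *
      ((θ - α) * h1 - p * h4 - hpβ)
  · linear_combination r ^ 2 * s ^ 2 * sin (φ / 2) ^ 2 * h1
end

section
/- Fix an integer n ≥ 3, reals r > 0, ε ∈ [0,1) with 4(1−ε)² ≥ (π²/n²)·cot²(π/n), set b_n = r·√(4(1−ε)² − (π²/n²)·cot²(π/n)), fix i ∈ {0,…,n−1} and α_i = 2iπ/n, and define σ(φ,θ) = (X,Y,Z) by X = r√(2/(1−ε))·(π cos α_i/(n sin(π/n)) − sin((2i+1)π/n)·(θ − α_i))·sin(φ/2), Y = r√(2/(1−ε))·(π sin α_i/(n sin(π/n)) + cos((2i+1)π/n)·(θ − α_i))·sin(φ/2), Z = εr + b_n(1 − √(2/(1−ε))·sin(φ/2)). Then for all (φ,θ), with E' = |∂_φσ|², F' = ∂_φσ·∂_θσ and G' = |∂_θσ|², one has E'G' − (F')² = r⁴ sin²φ, which equals the quantity EG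 − F² for the standard parametrization of the sphere of radius r; hence the map T_n⁺ is area preserving. -/
open Real

/-- `E'G' − F'²` for the spherical-coordinate expression of the map `T_n⁺` equals
`r⁴ sin²φ`, the value of `EG − F²` for the standard parametrization of the sphere of
radius `r`; hence `T_n⁺` is area preserving. -/
theorem areaPreservingTnPlus (n : ℕ) (hn : 3 ≤ n) (r ε : ℝ)
    (hr : 0 < r) (hε0 : 0 ≤ ε) (hε1 : ε < 1)
    (hcond : 4 * (1 - ε) ^ 2 ≥ π ^ 2 / n ^ 2 * (cos (π / n) / sin (π / n)) ^ 2)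
    (i : ℕ) (hi : i < n) :
    let b : ℝ := r * sqrt (4 * (1 - ε) ^ 2 - π ^ 2 / n ^ 2 * (cos (π / n) / sin (π / n)) ^ 2)
    let α : ℝ := 2 * i * π / n
    let X : ℝ → ℝ → ℝ := fun φ θ =>
      r * sqrt (2 / (1 - ε)) *
        (π * cos α / (n * sin (π / n)) - sin ((2 * i + 1) * π / n) * (θ - α)) * sin (φ / 2)
    let Y : ℝ → ℝ → ℝ := fun φ θ =>
      r * sqrt (2 / (1 - ε)) *
        (π * sin α / (n * sin (π / n)) + cos ((2 * i + 1) * π / n) * (θ - α)) * sin (φ / 2)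
    let Z : ℝ → ℝ → ℝ := fun φ _ => ε * r + b * (1 - sqrt (2 / (1 - ε)) * sin (φ / 2))
    -- standard parametrization of the sphere of radius r
    let x : ℝ → ℝ → ℝ := fun φ θ => r * cos θ * sin φ
    let y : ℝ → ℝ → ℝ := fun φ θ => r * sin θ * sin φ
    let z : ℝ → ℝ → ℝ := fun φ _ => r * cos φ
    ∀ φ θ : ℝ,
      ((deriv (fun p => X p θ) φ) ^ 2 + (deriv (fun p => Y p θ) φ) ^ 2 +
            (deriv (fun p => Z p θ) φ) ^ 2) *
          ((deriv (fun t => X φ t) θ) ^ 2 + (deriv (fun t => Y φ t) θ) ^ 2 +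
            (deriv (fun t => Z φ t) θ) ^ 2) -
          ((deriv (fun p => X p θ) φ) * (deriv (fun t => X φ t) θ) +
            (deriv (fun p => Y p θ) φ) * (deriv (fun t => Y φ t) θ) +
            (deriv (fun p => Z p θ) φ) * (deriv (fun t => Z φ t) θ)) ^ 2
        = r ^ 4 * sin φ ^ 2 ∧
      ((deriv (fun p => x p θ) φ) ^ 2 + (deriv (fun p => y p θ) φ) ^ 2 +
            (deriv (fun p => z p θ) φ) ^ 2) *
          ((deriv (fun t => x φ t) θ) ^ 2 + (deriv (fun t => y φ t) θ) ^ 2 +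
            (deriv (fun t => z φ t) θ) ^ 2) -
          ((deriv (fun p => x p θ) φ) * (deriv (fun t => x φ t) θ) +
            (deriv (fun p => y p θ) φ) * (deriv (fun t => y φ t) θ) +
            (deriv (fun p => z p θ) φ) * (deriv (fun t => z φ t) θ)) ^ 2
        = r ^ 4 * sin φ ^ 2 := by
  intro b α X Y Z x y z φ θ
  have hn0 : (n : ℝ) ≠ 0 := by
    have : n ≠ 0 := by omega
    exact_mod_cast this
  have hd : 1 - ε ≠ 0 := by linarith
  have hq : sqrt (2 / (1 - ε)) ^ 2 = 2 / (1 - ε) :=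
    Real.sq_sqrt (div_nonneg (by norm_num) (by linarith))
  have hb : b ^ 2 = r ^ 2 * (4 * (1 - ε) ^ 2
      - π ^ 2 / n ^ 2 * (cos (π / n) / sin (π / n)) ^ 2) := by
    simp only [b]
    rw [mul_pow, Real.sq_sqrt (by linarith)]
  have hs : HasDerivAt (fun p : ℝ => sin (p / 2)) (cos (φ / 2) * (1 / 2)) φ :=
    ((hasDerivAt_id φ).div_const 2).sin
  have hβ : (2 * i + 1) * π / n - α = π / n := by
    simp only [α]; field_simp; ring
  have hAC : cos α * cos ((2 * i + 1) * π / n) + sin α * sin ((2 * i + 1) * π / n)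
      = cos (π / n) := by
    rw [← hβ, cos_sub]; ring
  have hlin : HasDerivAt (fun t : ℝ => t - α) 1 θ := (hasDerivAt_id θ).sub_const α
  constructor
  · have h1 : deriv (fun p => X p θ) φ = _ := (hs.const_mul _).deriv
    have h2 : deriv (fun p => Y p θ) φ = _ := (hs.const_mul _).deriv
    have h3 : deriv (fun p => Z p θ) φ = _ :=
      ((((hs.const_mul (sqrt (2 / (1 - ε)))).const_sub 1).const_mul b).const_add (ε * r)).deriv
    have h4 : deriv (fun t => X φ t) θ = _ :=
      ((((hlin.const_mul (sin ((2 * i + 1) * π / n))).const_sub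
        (π * cos α / (n * sin (π / n)))).const_mul (r * sqrt (2 / (1 - ε)))).mul_const
          (sin (φ / 2))).deriv
    have h5 : deriv (fun t => Y φ t) θ = _ :=
      ((((hlin.const_mul (cos ((2 * i + 1) * π / n))).const_add
        (π * sin α / (n * sin (π / n)))).const_mul (r * sqrt (2 / (1 - ε)))).mul_const
          (sin (φ / 2))).deriv
    have h6 : deriv (fun t => Z φ t) θ = 0 := deriv_const _ _
    rw [h1, h2, h3, h4, h5, h6]
    have h2φ : sin φ = 2 * sin (φ / 2) * cos (φ / 2) := by
      rw [← sin_two_mul]; congr 1; ring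
    rw [h2φ]
    have hSC := sin_sq_add_cos_sq ((2 * i + 1) * π / n)
    set S := sin ((2 * i + 1) * π / n)
    set C := cos ((2 * i + 1) * π / n)
    set q := sqrt (2 / (1 - ε))
    set s := sin (φ / 2)
    set c := cos (φ / 2)
    set A := π * cos α / (n * sin (π / n)) - S * (θ - α) with hA
    set B := π * sin α / (n * sin (π / n)) + C * (θ - α) with hB
    have hAB : A * C + B * S = π / n * (cos (π / n) / sin (π / n)) := by
      rw [← hAC, hA, hB]
      simp only [div_eq_mul_inv, mul_inv]
      ring
    have hK : (A * C + B * S) ^ 2 * r ^ 2 + b ^ 2 = r ^ 2 * (4 * (1 - ε) ^ 2) := by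
      rw [hAB, hb]; ring
    have hqd : (q ^ 2) ^ 2 * (1 - ε) ^ 2 = 4 := by
      rw [hq]; field_simp; norm_num
    clear_value A B S C q s c b
    have hC : C ^ 2 = 1 - S ^ 2 := by linarith
    have key : ((A * C + B * S) ^ 2 * r ^ 2 + b ^ 2 * (S ^ 2 + C ^ 2)) * (r ^ 2 * (q ^ 2) ^ 2 * s ^ 2 * c ^ 2 / 4)
        = r ^ 4 * (2 * s * c) ^ 2 := by
      rw [hSC, mul_one, hK]
      linear_combination (r ^ 4 * s ^ 2 * c ^ 2) * hqd
    rw [← key]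
    ring
  · have h1 : deriv (fun p => x p θ) φ = _ := ((hasDerivAt_sin φ).const_mul _).deriv
    have h2 : deriv (fun p => y p θ) φ = _ := ((hasDerivAt_sin φ).const_mul _).deriv
    have h3 : deriv (fun p => z p θ) φ = _ := ((hasDerivAt_cos φ).const_mul _).deriv
    have h4 : deriv (fun t => x φ t) θ = _ :=
      (((hasDerivAt_cos θ).const_mul r).mul_const (sin φ)).deriv
    have h5 : deriv (fun t => y φ t) θ = _ :=
      (((hasDerivAt_sin θ).const_mul r).mul_const (sin φ)).deriv
    have h6 : deriv (fun t => z φ t) θ = 0 := deriv_const _ _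
    rw [h1, h2, h3, h4, h5, h6]
    have e1 : cos θ ^ 2 = 1 - sin θ ^ 2 := by linarith [sin_sq_add_cos_sq θ]
    have e2 : cos φ ^ 2 = 1 - sin φ ^ 2 := by linarith [sin_sq_add_cos_sq φ]
    have key : r ^ 4 * sin φ ^ 2 * ((sin θ ^ 2 + cos θ ^ 2) * (cos φ ^ 2 * (sin θ ^ 2 + cos θ ^ 2) + sin φ ^ 2))
        = r ^ 4 * sin φ ^ 2 := by
      rw [sin_sq_add_cos_sq, mul_one, cos_sq_add_sin_sq]; ring
    rw [← key]
    ring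
end

section
/- Fix an integer n ≥ 3, reals r > 0, ε ∈ [0,1) with 4(1−ε)² ≥ (π²/n²)·cot²(π/n), and set R_n = πr/(n sin(π/n)) and b_n = r·√(4(1−ε)² − (π²/n²)·cot²(π/n)). Let (x,y,z) satisfy x² + y² + z² = r², εr ≤ z < r and x > 0, and define X = √(r(r−z)/(1−ε))·(π/(n sin(π/n)) − sin(π/n)·arctan(y/x)), Y = √(r(r−z)/(1−ε))·cos(π/n)·arctan(y/x), Z = εr + b_n·(1 − √((1 − z/r)/(1−ε))). Then X·b_n + Y·b_n·tan(π/n) + Z·R_n = (b_n + εr)·R_n; that is, the image point lies in the plane of the lateral face F_0⁺ of the pyramid P_n⁺. -/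
open Real

/-- The image of a point of the spherical cap `{z ≥ εr}` (in the sector `x > 0`) under the
map `T_n⁺` lies in the plane of the lateral face `F_0⁺` of the pyramid `P_n⁺`. -/
theorem imageLiesOnFace (n : ℕ) (hn : 3 ≤ n) (r ε : ℝ)
    (hr : 0 < r) (hε0 : 0 ≤ ε) (hε1 : ε < 1)
    (hcond : 4 * (1 - ε) ^ 2 ≥ π ^ 2 / n ^ 2 * (cos (π / n) / sin (π / n)) ^ 2)
    (x y z : ℝ) (hsph : x ^ 2 + y ^ 2 + z ^ 2 = r ^ 2)
    (hz1 : ε * r ≤ z) (hz2 : z < r) (hx : 0 < x) :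
    let R : ℝ := π * r / (n * sin (π / n))
    let b : ℝ := r * sqrt (4 * (1 - ε) ^ 2 - π ^ 2 / n ^ 2 * (cos (π / n) / sin (π / n)) ^ 2)
    let X : ℝ := sqrt (r * (r - z) / (1 - ε)) *
      (π / (n * sin (π / n)) - sin (π / n) * arctan (y / x))
    let Y : ℝ := sqrt (r * (r - z) / (1 - ε)) * cos (π / n) * arctan (y / x)
    let Z : ℝ := ε * r + b * (1 - sqrt ((1 - z / r) / (1 - ε)))
    X * b + Y * b * tan (π / n) + Z * R = (b + ε * r) * R := by
  intro R b X Y Z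
  have hn' : (3 : ℝ) ≤ n := by exact_mod_cast hn
  have hcos : cos (π / n) ≠ 0 := by
    apply ne_of_gt
    apply cos_pos_of_mem_Ioo
    constructor
    · have : 0 < π / n := by positivity
      linarith [pi_pos]
    · rw [div_lt_div_iff₀ (by linarith) (by norm_num)]
      nlinarith [pi_pos]
  have ht : cos (π / n) * tan (π / n) = sin (π / n) := by
    rw [mul_comm]
    exact tan_mul_cos hcos
  have hS : sqrt (r * (r - z) / (1 - ε)) = r * sqrt ((1 - z / r) / (1 - ε)) := by
    have h : r * (r - z) / (1 - ε) = r ^ 2 * ((1 - z / r) / (1 - ε)) := by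
      field_simp
    rw [h, sqrt_mul (sq_nonneg r), sqrt_sq hr.le]
  have hR : R = r * (π / (n * sin (π / n))) := by
    simp only [R]
    ring
  have hX : X = r * sqrt ((1 - z / r) / (1 - ε)) *
      (π / (n * sin (π / n)) - sin (π / n) * arctan (y / x)) := by
    simp only [X, hS]
  have hY : Y = r * sqrt ((1 - z / r) / (1 - ε)) * cos (π / n) * arctan (y / x) := by
    simp only [Y, hS]
  have hZ : Z = ε * r + b * (1 - sqrt ((1 - z / r) / (1 - ε))) := rfl
  clear_value R b X Y Z
  rw [hX, hY, hZ, hR]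
  linear_combination (r * sqrt ((1 - z / r) / (1 - ε)) * arctan (y / x) * b) * ht
end

section
/- Fix an integer n ≥ 3, reals r > 0, ε ∈ [0,1) with 4(1−ε)² > (π²/n²)·cot²(π/n), and set b_n = r·√(4(1−ε)² − (π²/n²)·cot²(π/n)). Let (x,y,z) satisfy x² + y² + z² = r², εr ≤ z < r, x > 0 and y ≥ 0, and define X = √(r(r−z)/(1−ε))·(π/(n sin(π/n)) − sin(π/n)·arctan(y/x)), Y = √(r(r−z)/(1−ε))·cos(π/n)·arctan(y/x), Z = εr + b_n·(1 − √((1 − z/r)/(1−ε))). Then z = r − r(1−ε)·(1 − (Z − εr)/b_n)², x = √(r² − z²)·cos( πY / (n sin(π/n)·(X cos(π/n) + Y sin(π/n))) ), and y = √(r² − z²)·sin( πY / (n sin(π/n)·(X cos(π/n) + Y sin(π/n))) ); in particular X cos(π/n) + Y sin(π/n) ≠ 0 and the stated formulas invert the map T_n⁺ on this sector. -/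
open Real

/-- The explicit inversion formulas for the map `T_n⁺` on the sector
`x > 0`, `y ≥ 0` of the spherical cap `{z ≥ εr}`. -/
theorem inverseOfTnPlus (n : ℕ) (hn : 3 ≤ n) (r ε : ℝ)
    (hr : 0 < r) (hε0 : 0 ≤ ε) (hε1 : ε < 1)
    (hcond : 4 * (1 - ε) ^ 2 > π ^ 2 / n ^ 2 * (cos (π / n) / sin (π / n)) ^ 2)
    (x y z : ℝ) (hsph : x ^ 2 + y ^ 2 + z ^ 2 = r ^ 2)
    (hz1 : ε * r ≤ z) (hz2 : z < r) (hx : 0 < x) (hy : 0 ≤ y) :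
    let b : ℝ := r * sqrt (4 * (1 - ε) ^ 2 - π ^ 2 / n ^ 2 * (cos (π / n) / sin (π / n)) ^ 2)
    let X : ℝ := sqrt (r * (r - z) / (1 - ε)) *
      (π / (n * sin (π / n)) - sin (π / n) * arctan (y / x))
    let Y : ℝ := sqrt (r * (r - z) / (1 - ε)) * cos (π / n) * arctan (y / x)
    let Z : ℝ := ε * r + b * (1 - sqrt ((1 - z / r) / (1 - ε)))
    X * cos (π / n) + Y * sin (π / n) ≠ 0 ∧
    z = r - r * (1 - ε) * (1 - (Z - ε * r) / b) ^ 2 ∧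
    x = sqrt (r ^ 2 - z ^ 2) *
      cos (π * Y / (n * sin (π / n) * (X * cos (π / n) + Y * sin (π / n)))) ∧
    y = sqrt (r ^ 2 - z ^ 2) *
      sin (π * Y / (n * sin (π / n) * (X * cos (π / n) + Y * sin (π / n)))) := by
  intro b X Y Z
  have hn0 : (3 : ℝ) ≤ n := by exact_mod_cast hn
  have hnp : (0 : ℝ) < n := by linarith
  have hlt : π / n < π / 2 := by
    apply div_lt_div_of_pos_left pi_pos <;> linarith
  have hpos : 0 < π / n := div_pos pi_pos hnp
  have hs : 0 < sin (π / n) := sin_pos_of_pos_of_lt_pi hpos (by linarith [pi_pos])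
  have hc : 0 < cos (π / n) := cos_pos_of_mem_Ioo ⟨by linarith [pi_pos], hlt⟩
  have he : 0 < 1 - ε := by linarith
  have hS : 0 < sqrt (r * (r - z) / (1 - ε)) :=
    sqrt_pos.mpr (div_pos (mul_pos hr (by linarith)) he)
  have hb : 0 < b := mul_pos hr (sqrt_pos.mpr (by linarith))
  have hden : X * cos (π / n) + Y * sin (π / n)
      = sqrt (r * (r - z) / (1 - ε)) * (π * cos (π / n) / (n * sin (π / n))) := by
    simp only [X, Y]; ring
  have hpi := pi_pos
  have hdpos : 0 < X * cos (π / n) + Y * sin (π / n) := by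
    rw [hden]; positivity
  have hang : π * Y / (n * sin (π / n) * (X * cos (π / n) + Y * sin (π / n)))
      = arctan (y / x) := by
    rw [hden]
    simp only [Y]
    generalize sqrt (r * (r - z) / (1 - ε)) = S at hS
    generalize arctan (y / x) = a
    generalize sin (π / n) = s at hs
    generalize cos (π / n) = c at hc
    field_simp
  have hR : r ^ 2 - z ^ 2 = x ^ 2 * (1 + (y / x) ^ 2) := by
    field_simp; linarith
  have hq : 0 < sqrt (1 + (y / x) ^ 2) := sqrt_pos.mpr (by positivity)
  have hR2 : sqrt (r ^ 2 - z ^ 2) = x * sqrt (1 + (y / x) ^ 2) := by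
    rw [hR, sqrt_mul (sq_nonneg x), sqrt_sq hx.le]
  refine ⟨hdpos.ne', ?_, ?_, ?_⟩
  · have h1 : 1 - (Z - ε * r) / b = sqrt ((1 - z / r) / (1 - ε)) := by
      simp only [Z]
      field_simp
      ring
    have h2 : 0 ≤ (1 - z / r) / (1 - ε) := by
      apply div_nonneg _ he.le
      rw [sub_nonneg, div_le_one hr]; exact hz2.le
    rw [h1, sq_sqrt h2]
    field_simp
    ring
  · rw [hang, hR2, cos_arctan]
    field_simp
  · rw [hang, hR2, sin_arctan]
    field_simp
end

section
/- Fix an integer n ≥ 3 and ε ∈ [0,1) with 4(1−ε)² ≥ (π²/n²)·cot²(π/n), and set c(ε) = √(4(1−ε)² − (π²/n²)·cot²(π/n)), γ = 2(ε + c(ε)/3)·(π²/n)·cot(π/n), β = 4π/3, ξ = (β/γ)^{1/3}. Define V_n on the open region {(x,y,z) : x > 0, y > 0, ε·ρ < z < ρ, where ρ = √(x²+y²+z²)} by X = ξ·√(ρ(ρ−z)/(1−ε))·(π/(n sin(π/n)) − sin(π/n)·arctan(y/x)), Y = ξ·√(ρ(ρ−z)/(1−ε))·cos(π/n)·arctan(y/x),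 Z = ξ·ρ·(ε + c(ε)·(1 − √((1 − z/ρ)/(1−ε)))). Then at every point of this region V_n is differentiable and its Jacobian determinant equals (c(ε) + ε) / ((1−ε)(c(ε) + 3ε)). -/
open Real

/-- The linear functional with coefficients `a, b, c`. -/
noncomputable def capLin (a b c : ℝ) : ℝ × ℝ × ℝ →L[ℝ] ℝ :=
  a • ContinuousLinearMap.fst ℝ ℝ (ℝ × ℝ)
    + b • (ContinuousLinearMap.fst ℝ ℝ ℝ).comp (ContinuousLinearMap.snd ℝ ℝ (ℝ × ℝ))
    + c • (ContinuousLinearMap.snd ℝ ℝ ℝ).comp (ContinuousLinearMap.snd ℝ ℝ (ℝ × ℝ))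

lemma capLin_apply (a b c : ℝ) (v : ℝ × ℝ × ℝ) :
    capLin a b c v = a * v.1 + b * v.2.1 + c * v.2.2 := by
  simp [capLin]

/-- Identification of `ℝ × ℝ × ℝ` with `Fin 3 → ℝ`. -/
def capEquiv : (ℝ × ℝ × ℝ) ≃ₗ[ℝ] (Fin 3 → ℝ) where
  toFun v := ![v.1, v.2.1, v.2.2]
  invFun w := (w 0, w 1, w 2)
  map_add' u v := by ext i; fin_cases i <;> simp
  map_smul' a v := by ext i; fin_cases i <;> simp
  left_inv v := by simp
  right_inv w := by ext i; fin_cases i <;> simp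

lemma cap_det (a b c d e f g h i : ℝ) :
    ((capLin a b c).prod ((capLin d e f).prod (capLin g h i))).det
      = a * (e * i - f * h) - b * (d * i - f * g) + c * (d * h - e * g) := by
  rw [ContinuousLinearMap.det, ← LinearMap.det_conj _ capEquiv, ← LinearMap.det_toMatrix',
    Matrix.det_fin_three]
  simp [LinearMap.toMatrix'_apply, capEquiv, capLin_apply]
  ring

lemma cap_rho (x y z r : ℝ) (hr : 0 < r) (h : r = sqrt (x ^ 2 + y ^ 2 + z ^ 2)) :
    HasFDerivAt (fun p : ℝ × ℝ × ℝ => sqrt (p.1 ^ 2 + p.2.1 ^ 2 + p.2.2 ^ 2))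
      (capLin (x / r) (y / r) (z / r)) (x, y, z) := by
  have h1 : HasFDerivAt (fun p : ℝ × ℝ × ℝ => p.1) (capLin 1 0 0) (x, y, z) := by
    convert (capLin 1 0 0).hasFDerivAt using 1; ext p; simp [capLin_apply]
  have h2 : HasFDerivAt (fun p : ℝ × ℝ × ℝ => p.2.1) (capLin 0 1 0) (x, y, z) := by
    convert (capLin 0 1 0).hasFDerivAt using 1; ext p; simp [capLin_apply]
  have h3 : HasFDerivAt (fun p : ℝ × ℝ × ℝ => p.2.2) (capLin 0 0 1) (x, y, z) := by
    convert (capLin 0 0 1).hasFDerivAt using 1; ext p; simp [capLin_apply]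
  have hne : x ^ 2 + y ^ 2 + z ^ 2 ≠ 0 := by
    intro h0; rw [h0, sqrt_zero] at h; linarith
  have := (((h1.pow 2).add (h2.pow 2)).add (h3.pow 2)).sqrt (by simpa using hne)
  refine this.congr_fderiv ?_
  refine ContinuousLinearMap.ext fun v => ?_
  simp [capLin_apply, ← h]
  field_simp

lemma cap_div {f g : ℝ × ℝ × ℝ → ℝ} {df dg : ℝ × ℝ × ℝ →L[ℝ] ℝ} {p : ℝ × ℝ × ℝ}
    (hf : HasFDerivAt f df p) (hg : HasFDerivAt g dg p) (h0 : g p ≠ 0) :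
    HasFDerivAt (fun q => f q / g q) ((1 / g p) • df - (f p / g p ^ 2) • dg) p := by
  have hi : HasFDerivAt (fun q => (g q)⁻¹) _ p := (hasDerivAt_inv h0).comp_hasFDerivAt p hg
  have hm : HasFDerivAt (fun q => f q * (g q)⁻¹) _ p := hf.mul hi
  simp only [← div_eq_mul_inv] at hm
  refine hm.congr_fderiv ?_
  refine ContinuousLinearMap.ext fun v => ?_
  simp
  field_simp
  ring

lemma cap_theta (x y z : ℝ) (hx : 0 < x) :
    HasFDerivAt (fun p : ℝ × ℝ × ℝ => arctan (p.2.1 / p.1))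
      (capLin (-y / (x ^ 2 + y ^ 2)) (x / (x ^ 2 + y ^ 2)) 0) (x, y, z) := by
  have h1 : HasFDerivAt (fun p : ℝ × ℝ × ℝ => p.1) (capLin 1 0 0) (x, y, z) := by
    convert (capLin 1 0 0).hasFDerivAt using 1; ext p; simp [capLin_apply]
  have h2 : HasFDerivAt (fun p : ℝ × ℝ × ℝ => p.2.1) (capLin 0 1 0) (x, y, z) := by
    convert (capLin 0 1 0).hasFDerivAt using 1; ext p; simp [capLin_apply]
  have hq : HasFDerivAt (fun p : ℝ × ℝ × ℝ => p.2.1 / p.1) _ (x, y, z) :=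
    cap_div h2 h1 hx.ne'
  refine hq.arctan.congr_fderiv ?_
  refine ContinuousLinearMap.ext fun v => ?_
  have : x ^ 2 + y ^ 2 ≠ 0 := by positivity
  simp [capLin_apply]
  field_simp
  ring

lemma cap_T (x y z r t ε : ℝ) (hε1 : ε < 1) (hr : 0 < r) (h : r = sqrt (x ^ 2 + y ^ 2 + z ^ 2))
    (ht : 0 < t) (hteq : t = sqrt ((1 - z / r) / (1 - ε))) :
    HasFDerivAt (fun p : ℝ × ℝ × ℝ =>
        sqrt ((1 - p.2.2 / sqrt (p.1 ^ 2 + p.2.1 ^ 2 + p.2.2 ^ 2)) / (1 - ε)))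
      (capLin (x * z / r ^ 3 / (2 * t * (1 - ε))) (y * z / r ^ 3 / (2 * t * (1 - ε)))
        ((z ^ 2 / r ^ 3 - 1 / r) / (2 * t * (1 - ε)))) (x, y, z) := by
  have h3 : HasFDerivAt (fun p : ℝ × ℝ × ℝ => p.2.2) (capLin 0 0 1) (x, y, z) := by
    convert (capLin 0 0 1).hasFDerivAt using 1; ext p; simp [capLin_apply]
  have hρ := cap_rho x y z r hr h
  have hq : HasFDerivAt (fun p : ℝ × ℝ × ℝ =>
      p.2.2 / sqrt (p.1 ^ 2 + p.2.1 ^ 2 + p.2.2 ^ 2)) _ (x, y, z) :=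
    cap_div h3 hρ (by simp only []; rw [← h]; exact hr.ne')
  have hq2 : HasFDerivAt (fun p : ℝ × ℝ × ℝ =>
      (1 - p.2.2 / sqrt (p.1 ^ 2 + p.2.1 ^ 2 + p.2.2 ^ 2)) * (1 - ε)⁻¹) _ (x, y, z) :=
    (hq.const_sub 1).mul_const (1 - ε)⁻¹
  simp only [← div_eq_mul_inv (_ - _)] at hq2
  have := hq2.sqrt (by
    simp only [← h]; intro h0; rw [h0, sqrt_zero] at hteq; linarith)
  refine this.congr_fderiv ?_
  refine ContinuousLinearMap.ext fun v => ?_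
  have : 1 - ε ≠ 0 := by linarith
  simp [capLin_apply, ← h, ← hteq]
  field_simp
  ring

/-- On the (open sector of the) upper conical region `{ερ < z < ρ}`, the map `V_n` is
differentiable with Jacobian determinant `(c(ε) + ε) / ((1−ε)(c(ε) + 3ε))`. -/
theorem jacobianOnCap (n : ℕ) (hn : 3 ≤ n) (ε : ℝ) (hε0 : 0 ≤ ε) (hε1 : ε < 1)
    (hcond : 4 * (1 - ε) ^ 2 ≥ π ^ 2 / n ^ 2 * (cos (π / n) / sin (π / n)) ^ 2) :
    let c : ℝ := sqrt (4 * (1 - ε) ^ 2 - π ^ 2 / n ^ 2 * (cos (π / n) / sin (π / n)) ^ 2)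
    let γ : ℝ := 2 * (ε + c / 3) * (π ^ 2 / n) * (cos (π / n) / sin (π / n))
    let β : ℝ := 4 * π / 3
    let ξ : ℝ := (β / γ) ^ ((1 : ℝ) / 3)
    let ρ : ℝ × ℝ × ℝ → ℝ := fun p => sqrt (p.1 ^ 2 + p.2.1 ^ 2 + p.2.2 ^ 2)
    let V : ℝ × ℝ × ℝ → ℝ × ℝ × ℝ := fun p =>
      (ξ * sqrt (ρ p * (ρ p - p.2.2) / (1 - ε)) *
          (π / (n * sin (π / n)) - sin (π / n) * arctan (p.2.1 / p.1)),
        ξ * sqrt (ρ p * (ρ p - p.2.2) / (1 - ε)) * cos (π / n) * arctan (p.2.1 / p.1),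
        ξ * ρ p * (ε + c * (1 - sqrt ((1 - p.2.2 / ρ p) / (1 - ε)))))
    ∀ p : ℝ × ℝ × ℝ, 0 < p.1 → 0 < p.2.1 → ε * ρ p < p.2.2 → p.2.2 < ρ p →
      DifferentiableAt ℝ V p ∧
      (fderiv ℝ V p).det = (c + ε) / ((1 - ε) * (c + 3 * ε)) := by
  intro c γ β ξ ρ V p
  obtain ⟨x, y, z⟩ := p
  intro hx hy _ hzr
  simp only at hx hy hzr
  have hc : 0 ≤ c := sqrt_nonneg _
  have hn0 : (0 : ℝ) < n := by positivity
  have hn3 : (3 : ℝ) ≤ n := by exact_mod_cast hn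
  have hang : 0 < π / n := by positivity
  have hang2 : π / n < π / 2 := by
    apply div_lt_div_of_pos_left pi_pos (by norm_num); linarith
  have hk : 0 < cos (π / n) := cos_pos_of_mem_Ioo ⟨by linarith, hang2⟩
  have hs : 0 < sin (π / n) := sin_pos_of_pos_of_lt_pi hang (by linarith [pi_pos])
  have hε : 0 < 1 - ε := by linarith
  -- `ξ ^ 3 * (π / n) * cot (π / n) = 2 / (c + 3 ε)`
  have hξ : ξ ^ 3 * (π / (n * sin (π / n))) * cos (π / n) = 2 / (c + 3 * ε) := by
    have hγ : 0 ≤ γ := by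
      have : 0 ≤ ε + c / 3 := by positivity
      positivity
    have hβ : 0 ≤ β / γ := by
      have : 0 ≤ β := by positivity
      positivity
    have h3 : ξ ^ 3 = β / γ := by
      change ((β / γ) ^ ((1 : ℝ) / 3)) ^ 3 = _
      rw [← rpow_natCast, ← rpow_mul hβ]; norm_num
    rw [h3]
    simp only [β, γ]
    clear_value c
    rcases eq_or_ne (c + 3 * ε) 0 with h0 | h0
    · have : ε + c / 3 = 0 := by linarith
      rw [h0, this]; simp
    · have : ε + c / 3 = (c + 3 * ε) / 3 := by ring
      rw [this]
      have := pi_pos.ne'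
      field_simp
      norm_num
  obtain ⟨r, hr⟩ : ∃ r, r = sqrt (x ^ 2 + y ^ 2 + z ^ 2) := ⟨_, rfl⟩
  have hr0 : 0 < r := by rw [hr]; positivity
  have hr2 : r ^ 2 = x ^ 2 + y ^ 2 + z ^ 2 := by rw [hr]; exact sq_sqrt (by positivity)
  have hzlt : z < r := by rw [hr]; exact hzr
  obtain ⟨t, ht⟩ : ∃ t, t = sqrt ((1 - z / r) / (1 - ε)) := ⟨_, rfl⟩
  have ht0 : 0 < t := by
    rw [ht]; apply sqrt_pos.2
    have : z / r < 1 := (div_lt_one hr0).2 hzlt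
    exact div_pos (by linarith) hε
  have hρ := cap_rho x y z r hr0 hr
  have hθ := cap_theta x y z hx
  have hT := cap_T x y z r t ε hε1 hr0 hr ht0 ht
  have hR : ∀ p : ℝ × ℝ × ℝ, sqrt (ρ p * (ρ p - p.2.2) / (1 - ε))
      = ρ p * sqrt ((1 - p.2.2 / ρ p) / (1 - ε)) := by
    intro p
    have h0 : 0 ≤ ρ p := sqrt_nonneg _
    have : ρ p * (ρ p - p.2.2) / (1 - ε) = ρ p ^ 2 * ((1 - p.2.2 / ρ p) / (1 - ε)) := by
      rcases eq_or_ne (ρ p) 0 with h | h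
      · simp [h]
      · field_simp
    rw [this, sqrt_mul (sq_nonneg _), sqrt_sq h0]
  set θ := arctan (y / x) with hθdef
  set A := π / (n * sin (π / n)) with hA
  set s := sin (π / n) with hsdef
  set k := cos (π / n) with hkdef
  obtain ⟨r1, hr1⟩ : ∃ a, a = x / r := ⟨_, rfl⟩
  obtain ⟨r2, hry⟩ : ∃ a, a = y / r := ⟨_, rfl⟩
  obtain ⟨r3, hr3⟩ : ∃ a, a = z / r := ⟨_, rfl⟩
  obtain ⟨t1, ht1⟩ : ∃ a, a = x * z / r ^ 3 / (2 * t * (1 - ε)) := ⟨_, rfl⟩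
  obtain ⟨t2, ht2⟩ : ∃ a, a = y * z / r ^ 3 / (2 * t * (1 - ε)) := ⟨_, rfl⟩
  obtain ⟨t3, ht3⟩ : ∃ a, a = (z ^ 2 / r ^ 3 - 1 / r) / (2 * t * (1 - ε)) := ⟨_, rfl⟩
  obtain ⟨q1, hq1⟩ : ∃ a, a = -y / (x ^ 2 + y ^ 2) := ⟨_, rfl⟩
  obtain ⟨q2, hq2⟩ : ∃ a, a = x / (x ^ 2 + y ^ 2) := ⟨_, rfl⟩
  rw [← hr1, ← hry, ← hr3] at hρ
  rw [← ht1, ← ht2, ← ht3] at hT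
  rw [← hq1, ← hq2] at hθ
  have hD : r ^ 2 * t * ((t1 * q2 - t2 * q1) * r3 - t3 * (r1 * q2 - r2 * q1))
      = 1 / (2 * (1 - ε)) := by
    have hxy : x ^ 2 + y ^ 2 ≠ 0 := by positivity
    rw [hr1, hry, hr3, ht1, ht2, ht3, hq1, hq2]
    field_simp
    rw [hr2]; ring
  have hX : HasFDerivAt (fun p : ℝ × ℝ × ℝ => ξ * sqrt (ρ p * (ρ p - p.2.2) / (1 - ε)) *
          (A - s * arctan (p.2.1 / p.1)))
      (capLin (ξ * ((r1 * t + r * t1) * (A - s * θ) - s * (r * t) * q1))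
        (ξ * ((r2 * t + r * t2) * (A - s * θ) - s * (r * t) * q2))
        (ξ * ((r3 * t + r * t3) * (A - s * θ)))) (x, y, z) := by
    simp only [hR]
    refine (((hρ.mul hT).const_mul ξ).mul ((hθ.const_mul s).const_sub A)).congr_fderiv ?_
    refine ContinuousLinearMap.ext fun v => ?_
    simp [capLin_apply, ← hr, ← ht, ← hθdef]
    ring
  have hY : HasFDerivAt (fun p : ℝ × ℝ × ℝ => ξ * sqrt (ρ p * (ρ p - p.2.2) / (1 - ε)) * k *
          arctan (p.2.1 / p.1))
      (capLin (ξ * k * ((r1 * t + r * t1) * θ + (r * t) * q1))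
        (ξ * k * ((r2 * t + r * t2) * θ + (r * t) * q2))
        (ξ * k * ((r3 * t + r * t3) * θ))) (x, y, z) := by
    simp only [hR]
    refine ((((hρ.mul hT).const_mul ξ).mul_const k).mul hθ).congr_fderiv ?_
    refine ContinuousLinearMap.ext fun v => ?_
    simp [capLin_apply, ← hr, ← ht, ← hθdef]
    ring
  have hZ : HasFDerivAt (fun p : ℝ × ℝ × ℝ =>
        ξ * ρ p * (ε + c * (1 - sqrt ((1 - p.2.2 / ρ p) / (1 - ε)))))
      (capLin (ξ * (r1 * (ε + c * (1 - t)) - r * c * t1))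
        (ξ * (r2 * (ε + c * (1 - t)) - r * c * t2))
        (ξ * (r3 * (ε + c * (1 - t)) - r * c * t3))) (x, y, z) := by
    refine ((hρ.const_mul ξ).mul (((hT.const_sub 1).const_mul c).const_add ε)).congr_fderiv ?_
    refine ContinuousLinearMap.ext fun v => ?_
    simp [capLin_apply, ← hr, ← ht]
    ring
  have hV : HasFDerivAt V _ (x, y, z) := hX.prodMk (hY.prodMk hZ)
  refine ⟨hV.differentiableAt, ?_⟩
  rw [hV.fderiv, cap_det]
  have key : (c + ε) / ((1 - ε) * (c + 3 * ε))
      = (c + ε) * (2 / (c + 3 * ε)) * (1 / (2 * (1 - ε))) := by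
    rw [div_mul_eq_div_div, div_right_comm]
    field_simp
  rw [key, ← hD, ← hξ]
  ring
end

section
/- Fix an integer n ≥ 3 and ε ∈ [0,1) with 4(1−ε)² ≥ (π²/n²)·cot²(π/n), and set c(ε) = √(4(1−ε)² − (π²/n²)·cot²(π/n)), γ = 2(ε + c(ε)/3)·(π²/n)·cot(π/n), β = 4π/3, ξ = (β/γ)^{1/3}. Define V_n on the open region {(x,y,z) : x > 0, y > 0, |z| < ε·ρ, where ρ = √(x²+y²+z²)} by X = ξ·ρ·(π/(n sin(π/n)) − sin(π/n)·arctan(y/x)), Y = ξ·ρ·cos(π/n)·arctan(y/x), Z = ξ·z. Then at every point of this region V_n is differentiable and its Jacobian determinant equals 2/(3ε + c(ε)); in particular this determinant equals 1 if and only if c(ε) = 2 − 3ε. -/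
open Real

/-- The standard identification of `Fin 3 → ℝ` with `ℝ × ℝ × ℝ`. -/
def beltEquiv : (ℝ × ℝ × ℝ) ≃ₗ[ℝ] (Fin 3 → ℝ) where
  toFun p := ![p.1, p.2.1, p.2.2]
  invFun v := (v 0, v 1, v 2)
  map_add' p q := by ext i; fin_cases i <;> simp
  map_smul' a p := by ext i; fin_cases i <;> simp
  left_inv p := by simp
  right_inv v := by ext i; fin_cases i <;> simp

lemma det_prod3 (f : (ℝ × ℝ × ℝ) →L[ℝ] (ℝ × ℝ × ℝ)) :
    f.det = Matrix.det !![(f (1,0,0)).1, (f (0,1,0)).1, (f (0,0,1)).1;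
      (f (1,0,0)).2.1, (f (0,1,0)).2.1, (f (0,0,1)).2.1;
      (f (1,0,0)).2.2, (f (0,1,0)).2.2, (f (0,0,1)).2.2] := by
  have h : f.det = LinearMap.det (f : (ℝ × ℝ × ℝ) →ₗ[ℝ] (ℝ × ℝ × ℝ)) := rfl
  rw [h, ← LinearMap.det_toMatrix (Module.Basis.ofEquivFun beltEquiv)]
  congr 1
  ext i j
  rw [LinearMap.toMatrix_apply]
  have hb : (Module.Basis.ofEquivFun beltEquiv) j
      = beltEquiv.symm (Pi.single j 1) := by
    simp
  rw [hb]
  fin_cases i <;> fin_cases j <;> simp [beltEquiv]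

/-- On the (open sector of the) equatorial region `{|z| < ερ}`, the map `V_n` is
differentiable with Jacobian determinant `2/(3ε + c(ε))`, which equals `1` iff
`c(ε) = 2 − 3ε`. -/
theorem jacobianOnBelt (n : ℕ) (hn : 3 ≤ n) (ε : ℝ) (hε0 : 0 ≤ ε) (hε1 : ε < 1)
    (hcond : 4 * (1 - ε) ^ 2 ≥ π ^ 2 / n ^ 2 * (cos (π / n) / sin (π / n)) ^ 2) :
    let c : ℝ := sqrt (4 * (1 - ε) ^ 2 - π ^ 2 / n ^ 2 * (cos (π / n) / sin (π / n)) ^ 2)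
    let γ : ℝ := 2 * (ε + c / 3) * (π ^ 2 / n) * (cos (π / n) / sin (π / n))
    let β : ℝ := 4 * π / 3
    let ξ : ℝ := (β / γ) ^ ((1 : ℝ) / 3)
    let ρ : ℝ × ℝ × ℝ → ℝ := fun p => sqrt (p.1 ^ 2 + p.2.1 ^ 2 + p.2.2 ^ 2)
    let V : ℝ × ℝ × ℝ → ℝ × ℝ × ℝ := fun p =>
      (ξ * ρ p * (π / (n * sin (π / n)) - sin (π / n) * arctan (p.2.1 / p.1)),
        ξ * ρ p * cos (π / n) * arctan (p.2.1 / p.1),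
        ξ * p.2.2)
    (∀ p : ℝ × ℝ × ℝ, 0 < p.1 → 0 < p.2.1 → |p.2.2| < ε * ρ p →
      DifferentiableAt ℝ V p ∧
      (fderiv ℝ V p).det = 2 / (3 * ε + c)) ∧
    (2 / (3 * ε + c) = 1 ↔ c = 2 - 3 * ε) := by
  intro c γ β ξ ρ V
  have hc0 : 0 ≤ c := sqrt_nonneg _
  refine ⟨?_, ?_⟩
  · rintro ⟨x, y, z⟩ hx hy hz
    simp only at hx hy hz
    have hρ0 : 0 ≤ ρ (x, y, z) := sqrt_nonneg _
    have hε : 0 < ε := by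
      rcases hε0.eq_or_lt with h | h
      · rw [← h, zero_mul] at hz
        exact absurd hz (not_lt.mpr (abs_nonneg z))
      · exact h
    have hn' : (3 : ℝ) ≤ n := by exact_mod_cast hn
    have hn0 : (0 : ℝ) < n := by linarith
    have hlt : π / n < π / 2 := by
      apply div_lt_div_of_pos_left pi_pos <;> linarith
    have hpos : 0 < π / n := by positivity
    have hs : 0 < sin (π / n) := sin_pos_of_pos_of_lt_pi hpos (by linarith [pi_pos])
    have hk : 0 < cos (π / n) := cos_pos_of_mem_Ioo ⟨by linarith, hlt⟩
    have hγ : 0 < γ := by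
      have : 0 < ε + c / 3 := by positivity
      have := pi_pos
      simp only [γ]
      positivity
    have hβ : 0 < β := by have := pi_pos; simp only [β]; positivity
    have hξ : ξ ^ 3 = β / γ := by
      simp only [ξ]
      rw [← rpow_natCast, ← rpow_mul (by positivity)]
      norm_num
    have hq : 0 < x ^ 2 + y ^ 2 + z ^ 2 := by positivity
    have hr : 0 < ρ (x, y, z) := sqrt_pos.mpr hq
    have hr2 : ρ (x, y, z) ^ 2 = x ^ 2 + y ^ 2 + z ^ 2 := sq_sqrt hq.le
    -- derivatives of the ingredients
    have d1 : HasFDerivAt (fun p : ℝ × ℝ × ℝ => p.1)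
        (ContinuousLinearMap.fst ℝ ℝ (ℝ × ℝ)) (x, y, z) := hasFDerivAt_fst
    have d2' : HasFDerivAt (fun p : ℝ × ℝ × ℝ => p.2)
        (ContinuousLinearMap.snd ℝ ℝ (ℝ × ℝ)) (x, y, z) := hasFDerivAt_snd
    have d2 := d2'.fst
    have d3 := d2'.snd
    have dρ : HasFDerivAt ρ _ (x, y, z) :=
      (((d1.pow 2).add (d2.pow 2)).add (d3.pow 2)).sqrt hq.ne'
    have dinv : HasFDerivAt (fun p : ℝ × ℝ × ℝ => p.1⁻¹) _ (x, y, z) :=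
      (hasDerivAt_inv hx.ne').comp_hasFDerivAt (x, y, z) d1
    have dyx := d2.mul dinv
    have hfe : ((fun p : ℝ × ℝ × ℝ => p.2.1) * fun p : ℝ × ℝ × ℝ => p.1⁻¹)
        = fun p : ℝ × ℝ × ℝ => p.2.1 / p.1 := by
      funext p
      simp [div_eq_mul_inv]
    rw [hfe] at dyx
    have dθ : HasFDerivAt (fun p : ℝ × ℝ × ℝ => arctan (p.2.1 / p.1)) _ (x, y, z) :=
      dyx.arctan
    generalize hθ : arctan (y / x) = θ
    have dX := (dρ.const_mul ξ).mul
      ((dθ.const_mul (sin (π / n))).const_sub (π / (n * sin (π / n))))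
    have dY := ((dρ.const_mul ξ).mul_const (cos (π / n))).mul dθ
    have dZ := d3.const_mul ξ
    have dV : HasFDerivAt V _ (x, y, z) := dX.prodMk (dY.prodMk dZ)
    refine ⟨dV.differentiableAt, ?_⟩
    rw [dV.fderiv, det_prod3, Matrix.det_fin_three]
    have hsq : sqrt (x ^ 2 + y ^ 2 + z ^ 2) = ρ (x, y, z) := rfl
    have key : ξ ^ 3 * (π / (n * sin (π / n)) * cos (π / n)) = 2 / (3 * ε + c) := by
      rw [hξ]
      have h1 : 3 * ε + c ≠ 0 := by positivity
      have h2 : ε + c / 3 ≠ 0 := by positivity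
      have := pi_pos.ne'
      simp only [β, γ]
      field_simp
      ring
    rw [← key]
    simp [hsq]
    have hw : (1 + (y / x) ^ 2)⁻¹ = x ^ 2 / (x ^ 2 + y ^ 2) := by
      field_simp
    rw [hw]
    clear_value ξ ρ
    generalize π / (n * sin (π / n)) = a
    generalize arctan (y / x) = t
    generalize ρ (x, y, z) = r at hr
    generalize sin (π / n) = s
    generalize cos (π / n) = k
    have hxy : x ^ 2 + y ^ 2 ≠ 0 := by positivity
    have hr' := hr.ne'
    have hx' := hx.ne'
    field_simp
    ring
  · constructor
    · intro h
      have h1 : 3 * ε + c ≠ 0 := by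
        intro h0
        rw [h0] at h
        norm_num at h
      rw [div_eq_one_iff_eq h1] at h
      linarith
    · intro h
      rw [h]
      norm_num
end

section
/- Let ε₁ = (10 − √(100 − 5π² − 2√5·π²))/25 and ε₂ = (10 + √(100 − 5π² − 2√5·π²))/25. Then both ε₁ and ε₂ lie in [0, 1), satisfy 2 − 3ε ≥ 0 and 4(1−ε)² ≥ (π²/25)·cot²(π/5), and satisfy √(4(1−ε)² − (π²/25)·cot²(π/5)) = 2 − 3ε; that is, for n = 5 the equation c(ε) = 2 − 3ε is satisfied exactly by these two values (numerically ε₁ = 0.297912…, ε₂ = 0.502088…). -/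
open Real

/-- For `n = 5`, the values `ε = (10 ± √(100 − 5π² − 2√5·π²))/25` solve the volume
preserving condition `c(ε) = 2 − 3ε`. -/
theorem volumePreservingEpsN5 :
    let ε₁ : ℝ := (10 - sqrt (100 - 5 * π ^ 2 - 2 * sqrt 5 * π ^ 2)) / 25
    let ε₂ : ℝ := (10 + sqrt (100 - 5 * π ^ 2 - 2 * sqrt 5 * π ^ 2)) / 25
    (0 ≤ ε₁ ∧ ε₁ < 1 ∧ 2 - 3 * ε₁ ≥ 0 ∧
      4 * (1 - ε₁) ^ 2 ≥ π ^ 2 / 25 * (cos (π / 5) / sin (π / 5)) ^ 2 ∧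
      sqrt (4 * (1 - ε₁) ^ 2 - π ^ 2 / 25 * (cos (π / 5) / sin (π / 5)) ^ 2)
        = 2 - 3 * ε₁) ∧
    (0 ≤ ε₂ ∧ ε₂ < 1 ∧ 2 - 3 * ε₂ ≥ 0 ∧
      4 * (1 - ε₂) ^ 2 ≥ π ^ 2 / 25 * (cos (π / 5) / sin (π / 5)) ^ 2 ∧
      sqrt (4 * (1 - ε₂) ^ 2 - π ^ 2 / 25 * (cos (π / 5) / sin (π / 5)) ^ 2)
        = 2 - 3 * ε₂) := by
  have h5 : sqrt 5 ^ 2 = 5 := Real.sq_sqrt (by norm_num)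
  have h5p : 0 ≤ sqrt 5 := Real.sqrt_nonneg 5
  have h5l : sqrt 5 ≤ 2.237 := by
    exact Real.sqrt_le_iff.2 (by norm_num)
  have h5g : 2 ≤ sqrt 5 := by
    exact Real.le_sqrt_of_sq_le (by norm_num)
  have hpi : π ^ 2 ≤ 10 := by nlinarith [Real.pi_lt_d2, Real.pi_gt_d2, Real.pi_lt_d4]
  have hpi' : 9.8 ≤ π ^ 2 := by nlinarith [Real.pi_gt_d4]
  have hcot : (cos (π / 5) / sin (π / 5)) ^ 2 = 1 + 2 * sqrt 5 / 5 := by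
    rw [div_pow, Real.sin_sq, Real.cos_pi_div_five]
    have hne : 1 - ((1 + sqrt 5) / 4) ^ 2 ≠ 0 := by nlinarith
    rw [div_eq_iff hne]
    linear_combination (1 / 8 + (1 + 2 * sqrt 5 / 5) / 16 - 1 / 16 + 1 / 20) * h5
  have hD : 0 ≤ 100 - 5 * π ^ 2 - 2 * sqrt 5 * π ^ 2 := by
    nlinarith [mul_nonneg (sub_nonneg.2 h5l) (sq_nonneg π)]
  have hs2 := Real.sq_sqrt hD
  have hs0 := Real.sqrt_nonneg (100 - 5 * π ^ 2 - 2 * sqrt 5 * π ^ 2)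
  have hs6 : sqrt (100 - 5 * π ^ 2 - 2 * sqrt 5 * π ^ 2) ≤ 6 := by
    refine Real.sqrt_le_iff.2 ⟨by norm_num, ?_⟩
    nlinarith [mul_nonneg (sub_nonneg.2 h5g) (sq_nonneg π)]
  rw [hcot]
  generalize sqrt (100 - 5 * π ^ 2 - 2 * sqrt 5 * π ^ 2) = s at *
  intro ε₁ ε₂
  have key : ∀ e : ℝ, 0 ≤ e → e ≤ 16 / 25 → (25 * e - 10) ^ 2 = s ^ 2 →
      (0 ≤ e ∧ e < 1 ∧ 2 - 3 * e ≥ 0 ∧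
      4 * (1 - e) ^ 2 ≥ π ^ 2 / 25 * (1 + 2 * sqrt 5 / 5) ∧
      sqrt (4 * (1 - e) ^ 2 - π ^ 2 / 25 * (1 + 2 * sqrt 5 / 5)) = 2 - 3 * e) := by
    intro e h0 h1 h2
    have h3 : 4 * (1 - e) ^ 2 - π ^ 2 / 25 * (1 + 2 * sqrt 5 / 5) = (2 - 3 * e) ^ 2 := by
      linear_combination (-1 / 125) * h2 - (1 / 125) * hs2
    refine ⟨h0, by linarith, by linarith, ?_, ?_⟩
    · nlinarith [sq_nonneg (2 - 3 * e)]
    · rw [h3, Real.sqrt_sq (by linarith)]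
  refine ⟨key ε₁ ?_ ?_ ?_, key ε₂ ?_ ?_ ?_⟩ <;> simp only [ε₁, ε₂]
  · linarith
  · linarith
  · ring
  · linarith
  · linarith
  · ring
end

section
/- For every integer n ≥ 6 there is no ε ∈ [0, 1) such that 4(1−ε)² ≥ (π²/n²)·cot²(π/n) and √(4(1−ε)² − (π²/n²)·cot²(π/n)) = 2 − 3ε; that is, for n ≥ 6 the equation c(ε) = 2 − 3ε has no solution and the construction yields no volume preserving map V_n. -/
open Real

/-- For every integer `n ≥ 6` the volume preserving condition `c(ε) = 2 − 3ε` has no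
solution `ε ∈ [0, 1)`, so the construction yields no volume preserving map `V_n`. -/
theorem noVolumePreservingEps (n : ℕ) (hn : 6 ≤ n) :
    ¬ ∃ ε : ℝ, 0 ≤ ε ∧ ε < 1 ∧
      4 * (1 - ε) ^ 2 ≥ π ^ 2 / n ^ 2 * (cos (π / n) / sin (π / n)) ^ 2 ∧
      sqrt (4 * (1 - ε) ^ 2 - π ^ 2 / n ^ 2 * (cos (π / n) / sin (π / n)) ^ 2)
        = 2 - 3 * ε := by
  rintro ⟨ε, h0, h1, hge, heq⟩
  have hn' : (6 : ℝ) ≤ n := by exact_mod_cast hn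
  have hnp : (0 : ℝ) < n := by linarith
  rw [← div_pow] at hge heq
  have hx0 : 0 < π / n := by positivity
  have hx1 : π / n ≤ 0.5237 := by
    rw [div_le_iff₀ hnp]
    nlinarith [Real.pi_lt_d4]
  generalize π / (n : ℝ) = x at *
  have hsq := Real.sq_sqrt (sub_nonneg.mpr hge)
  rw [heq] at hsq
  have hs0 : 0 < sin x := Real.sin_pos_of_pos_of_lt_pi hx0 (by linarith [Real.pi_gt_three])
  have hc := Real.one_sub_sq_div_two_le_cos (x := x)
  have hs := (abs_le.mp (Real.sin_bound (x := x) (by rw [abs_of_pos hx0]; linarith))).2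
  rw [abs_of_pos hx0] at hs
  have hx2 : x ^ 2 ≤ 0.5237 ^ 2 := by gcongr
  have hx3 : x ^ 3 ≤ 0.5237 ^ 3 := by gcongr
  have hA : 0.8945 ≤ x * (cos x / sin x) := by
    rw [← mul_div_assoc, le_div_iff₀ hs0]
    have h2 : 0.8945 * (1 - x ^ 2 / 6 + x ^ 3 * (5 / 96)) ≤ cos x := by
      norm_num at hx2 hx3 ⊢
      linarith
    have h3 := mul_le_mul_of_nonneg_left h2 hx0.le
    nlinarith
  have hA2 : (0.8945 : ℝ) ^ 2 ≤ (x * (cos x / sin x)) ^ 2 := by gcongr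
  rw [mul_pow] at hA2
  norm_num at hA2
  nlinarith [sq_nonneg (5 * ε - 2)]
end
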